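/- For every reduced knot projection P, the inequality IR(P) ≤ (c(P) − 1)/2 holds, where c(P) is the number of crossings of P and IR(P) is the maximal independent region number of P; equivalently, 2·IR(P) ≤ c(P) − 1. -/

import Mathlib

/-!
Formalization framework for knot/link projections on the 2-sphere,
their regions, independent region sets, warping degree, and the
maximal independent region number, following Ohya–Shimizu,
"Lower bounds for the warping degree of a knot projection".
-/

noncomputable section
open Set

local instance : Fact ((0:ℝ) < 1) := ⟨zero_lt_one⟩

/-- The 2-sphere, realized as the unit sphere in ℝ³. -/
abbrev Sphere2 : Type := Metric.sphere (0 : EuclideanSpace ℝ (Fin 3)) 1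

/-- The parameter circle ℝ/ℤ. -/
abbrev Param : Type := AddCircle (1 : ℝ)

/-- The time (in `[0,1)`) needed to reach the point `t` when travelling from the
point `b` along the circle in the positive direction. -/
def timeFrom (b t : Param) : ℝ := ((AddCircle.equivIco 1 0) (t - b) : ℝ)

/-- A knot projection: a closed curve on the 2-sphere whose only
multiple points are finitely many transverse double points (crossings),
with at least one crossing.  (Each fibre of the parametrization is finite, of
cardinality at most two; the double points form a finite nonempty set.) -/
structure KnotProjection where
  /-- the parametrizing closed curve -/
  f : C(Param, Sphere2)
  fibers_finite : ∀ p : Sphere2, (f ⁻¹' {p} : Set Param).Finite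
  fibers_le_two : ∀ p : Sphere2, Nat.card (f ⁻¹' {p} : Set Param) ≤ 2
  crossings_finite : {p : Sphere2 | Nat.card (f ⁻¹' {p} : Set Param) = 2}.Finite
  exists_crossing : ∃ p : Sphere2, Nat.card (f ⁻¹' {p} : Set Param) = 2

namespace KnotProjection

/-- The image of the projection on the sphere. -/
def image (P : KnotProjection) : Set Sphere2 := Set.range P.f

/-- The crossings: the double points of the projection. -/
def crossings (P : KnotProjection) : Set Sphere2 :=
  {p : Sphere2 | Nat.card (P.f ⁻¹' {p} : Set Param) = 2}

/-- The crossing number `c(P)`. -/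
def crossingNumber (P : KnotProjection) : ℕ := Nat.card P.crossings

/-- A region: a connected component of the complement of the projection. -/
def IsRegion (P : KnotProjection) (R : Set Sphere2) : Prop :=
  ∃ x : Sphere2, x ∉ P.image ∧ R = connectedComponentIn P.imageᶜ x

/-- A region `R` is incident to a crossing `p` when `p` lies on the boundary of `R`. -/
def Incident (P : KnotProjection) (R : Set Sphere2) (p : Sphere2) : Prop :=
  P.IsRegion R ∧ p ∈ P.crossings ∧ p ∈ frontier R

/-- Two regions are independent when they share no crossing on their boundaries. -/
def IndepPair (P : KnotProjection) (R S : Set Sphere2) : Prop :=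
  ∀ p ∈ P.crossings, ¬(p ∈ frontier R ∧ p ∈ frontier S)

/-- A finite family of pairwise independent regions. -/
def IndepRegions (P : KnotProjection) (S : Finset (Set Sphere2)) : Prop :=
  (∀ R ∈ S, P.IsRegion R) ∧ (S : Set (Set Sphere2)).Pairwise P.IndepPair

/-- An independent region set for `P^c`: a finite family of pairwise independent
regions, none of which is incident to the base crossing `c`. -/
def IndepRegionsFor (P : KnotProjection) (c : Sphere2) (S : Finset (Set Sphere2)) : Prop :=
  P.IndepRegions S ∧ ∀ R ∈ S, c ∉ frontier R

/-- `IR(P^c)`: the maximal cardinality of an independent region set for `P^c`. -/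
def IRat (P : KnotProjection) (c : Sphere2) : ℕ :=
  sSup {m : ℕ | ∃ S : Finset (Set Sphere2), P.IndepRegionsFor c S ∧ m = S.card}

/-- `IR(P)`: the maximal independent region number of `P`. -/
def IR (P : KnotProjection) : ℕ :=
  sSup {m : ℕ | ∃ c ∈ P.crossings, m = P.IRat c}

/-- A crossing is reducible when two of the four local regions around it
coincide, i.e. when fewer than four regions are incident to it. -/
def Reducible (P : KnotProjection) (c : Sphere2) : Prop :=
  c ∈ P.crossings ∧ Nat.card {R : Set Sphere2 | P.IsRegion R ∧ c ∈ frontier R} < 4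

/-- A knot projection is reduced when it has no reducible crossing. -/
def Reduced (P : KnotProjection) : Prop := ∀ c : Sphere2, ¬ P.Reducible c

/-- Auxiliary: preimages under the reversal `t ↦ -t` have the same cardinality. -/
theorem card_neg_preimage (s : Set Param) :
    Nat.card ((Neg.neg : Param → Param) ⁻¹' s) = Nat.card s := by
  have h : (Neg.neg : Param → Param) ⁻¹' s = Neg.neg '' s := by
    ext t
    simp only [Set.mem_preimage, Set.mem_image]
    constructor
    · intro h; exact ⟨-t, h, neg_neg t⟩
    · rintro ⟨u, hu, rfl⟩; rwa [neg_neg]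
  rw [h, Nat.card_image_of_injective neg_injective]

/-- The same knot projection with the reversed orientation. -/
def reverse (P : KnotProjection) : KnotProjection where
  f := P.f.comp ⟨fun t => -t, continuous_neg⟩
  fibers_finite := by
    intro p
    have : (P.f.comp ⟨fun t => -t, continuous_neg⟩) ⁻¹' {p}
        = (Neg.neg : Param → Param) ⁻¹' (P.f ⁻¹' {p}) := rfl
    rw [this]
    exact (P.fibers_finite p).preimage (neg_injective.injOn)
  fibers_le_two := by
    intro p
    have : (P.f.comp ⟨fun t => -t, continuous_neg⟩) ⁻¹' {p}
        = (Neg.neg : Param → Param) ⁻¹' (P.f ⁻¹' {p}) := rfl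
    rw [this, card_neg_preimage]
    exact P.fibers_le_two p
  crossings_finite := by
    have : {p : Sphere2 |
        Nat.card ((P.f.comp ⟨fun t => -t, continuous_neg⟩) ⁻¹' {p} : Set Param) = 2}
        = {p : Sphere2 | Nat.card (P.f ⁻¹' {p} : Set Param) = 2} := by
      ext p
      have h : (P.f.comp ⟨fun t => -t, continuous_neg⟩) ⁻¹' {p}
          = (Neg.neg : Param → Param) ⁻¹' (P.f ⁻¹' {p}) := rfl
      simp only [Set.mem_setOf_eq, h, card_neg_preimage]
    rw [this]
    exact P.crossings_finite
  exists_crossing := by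
    obtain ⟨p, hp⟩ := P.exists_crossing
    refine ⟨p, ?_⟩
    have h : (P.f.comp ⟨fun t => -t, continuous_neg⟩) ⁻¹' {p}
        = (Neg.neg : Param → Param) ⁻¹' (P.f ⁻¹' {p}) := rfl
    rw [h, card_neg_preimage]
    exact hp

end KnotProjection

/-- A knot diagram: a knot projection together with over/under information; at
each crossing, `over` designates the parameter of the over-passage. -/
structure KnotDiagram extends KnotProjection where
  /-- the parameter at which the strand passes over the given crossing -/
  overParam : Sphere2 → Param
  over_mem : ∀ p ∈ toKnotProjection.crossings, toKnotProjection.f (overParam p) = p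

namespace KnotDiagram

/-- A passage through a crossing at parameter `t` is an over-passage when `t`
is the designated over-parameter of the crossing below. -/
def IsOverPass (D : KnotDiagram) (t : Param) : Prop :=
  t = D.overParam (D.toKnotProjection.f t)

/-- A diagram is alternating when, travelling along the diagram, consecutive
crossing passages are alternately over- and under-passages. -/
def Alternating (D : KnotDiagram) : Prop :=
  ∀ t₁ t₂ : Param,
    D.toKnotProjection.f t₁ ∈ D.toKnotProjection.crossings →
    D.toKnotProjection.f t₂ ∈ D.toKnotProjection.crossings →
    t₁ ≠ t₂ →
    (∀ s : Param, D.toKnotProjection.f s ∈ D.toKnotProjection.crossings →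
      s ≠ t₁ → s ≠ t₂ → timeFrom t₁ t₂ ≤ timeFrom t₁ s) →
    (D.IsOverPass t₁ ↔ ¬ D.IsOverPass t₂)

/-- A base point: a point of the diagram avoiding the crossings (given by its
parameter `b`). -/
def IsBasePoint (D : KnotDiagram) (b : Param) : Prop :=
  D.toKnotProjection.f b ∉ D.toKnotProjection.crossings

/-- A crossing `p` is a warping crossing point of `D_b` when, travelling from
`b`, one meets `p` first as an under-crossing, i.e. its under-passage occurs
strictly before its over-passage. -/
def IsWarping (D : KnotDiagram) (b : Param) (p : Sphere2) : Prop :=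
  p ∈ D.toKnotProjection.crossings ∧
  ∃ t : Param, D.toKnotProjection.f t = p ∧ t ≠ D.overParam p ∧
    timeFrom b t < timeFrom b (D.overParam p)

/-- The warping degree `d(D_b)` of the based diagram `D_b`. -/
def wdAt (D : KnotDiagram) (b : Param) : ℕ :=
  Nat.card {p : Sphere2 | D.IsWarping b p}

/-- The warping degree `d(D)` of the diagram: the minimum of `d(D_b)` over all
base points `b`. -/
def warpingDegree (D : KnotDiagram) : ℕ :=
  sInf {m : ℕ | ∃ b : Param, D.IsBasePoint b ∧ m = D.wdAt b}

end KnotDiagram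

/-- The warping degree `d(P)` of an (unoriented) knot projection: the minimal
warping degree of all oriented alternating diagrams obtained from `P` by
choosing an orientation and over/under information at every crossing. -/
def KnotProjection.warpingDegree (P : KnotProjection) : ℕ :=
  sInf {m : ℕ | ∃ D : KnotDiagram,
    (D.toKnotProjection = P ∨ D.toKnotProjection = P.reverse) ∧
    D.Alternating ∧ m = D.warpingDegree}

/-- A link projection: a closed curve with finitely many components on the
2-sphere whose only multiple points are finitely many double points. -/
structure LinkProjection where
  /-- the number of circle components -/
  comps : ℕ
  comps_pos : 0 < comps
  /-- the parametrizing curves -/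
  f : C(Fin comps × Param, Sphere2)
  fibers_finite : ∀ p : Sphere2, (f ⁻¹' {p} : Set (Fin comps × Param)).Finite
  fibers_le_two : ∀ p : Sphere2, Nat.card (f ⁻¹' {p} : Set (Fin comps × Param)) ≤ 2
  crossings_finite :
    {p : Sphere2 | Nat.card (f ⁻¹' {p} : Set (Fin comps × Param)) = 2}.Finite

namespace LinkProjection

/-- The image of the link projection on the sphere. -/
def image (L : LinkProjection) : Set Sphere2 := Set.range L.f

/-- The crossings: the double points of the projection. -/
def crossings (L : LinkProjection) : Set Sphere2 :=
  {p : Sphere2 | Nat.card (L.f ⁻¹' {p} : Set (Fin L.comps × Param)) = 2}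

/-- The crossing number of the link projection. -/
def crossingNumber (L : LinkProjection) : ℕ := Nat.card L.crossings

/-- A link projection is connected when its image is connected. -/
def Connected (L : LinkProjection) : Prop := IsConnected L.image

/-- A region: a connected component of the complement of the projection. -/
def IsRegion (L : LinkProjection) (R : Set Sphere2) : Prop :=
  ∃ x : Sphere2, x ∉ L.image ∧ R = connectedComponentIn L.imageᶜ x

/-- Two regions are independent when they share no crossing on their boundaries. -/
def IndepPair (L : LinkProjection) (R S : Set Sphere2) : Prop :=
  ∀ p ∈ L.crossings, ¬(p ∈ frontier R ∧ p ∈ frontier S)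

/-- A finite family of pairwise independent regions. -/
def IndepRegions (L : LinkProjection) (S : Finset (Set Sphere2)) : Prop :=
  (∀ R ∈ S, L.IsRegion R) ∧ (S : Set (Set Sphere2)).Pairwise L.IndepPair

/-- `L` has at least `m` pairwise independent regions. -/
def HasIndepRegions (L : LinkProjection) (m : ℕ) : Prop :=
  ∃ S : Finset (Set Sphere2), L.IndepRegions S ∧ m ≤ S.card

end LinkProjection


/-- Continuous nonvanishing functions on simply connected spaces have logarithms. -/
theorem kp_exists_log {A : Type*} [TopologicalSpace A] [SimplyConnectedSpace A]
    [LocallyPathConnectedSpace A] (h : A → ℂ) (hc : Continuous h) (h0 : ∀ x, h x ≠ 0) :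
    ∃ φ : A → ℂ, Continuous φ ∧ ∀ x, Complex.exp (φ x) = h x := by
  obtain ⟨a₀⟩ : Nonempty A := inferInstance
  obtain ⟨F, ⟨-, hF⟩, -⟩ := Complex.isCoveringMapOn_exp.existsUnique_continuousMap_lifts
    (⟨h, hc⟩ : C(A, ℂ)) (a₀ := a₀) (e₀ := Complex.log (h a₀)) (Complex.exp_log (h0 a₀))
    (fun a => h0 a)
  exact ⟨F, F.continuous, fun x => congrFun hF x⟩

theorem kp_log_Icc (c d : ℝ) (hcd : c ≤ d) (g : ℝ → ℂ) (hg : ContinuousOn g (Icc c d))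
    (h0 : ∀ t ∈ Icc c d, g t ≠ 0) :
    ∃ ψ : ℝ → ℂ, Continuous ψ ∧ ∀ t ∈ Icc c d, Complex.exp (ψ t) = g t := by
  have hc : Continuous (fun t : ℝ => g (projIcc c d hcd t)) :=
    (continuousOn_iff_continuous_domRestrict.1 hg).comp continuous_projIcc
  obtain ⟨ψ, hψ, he⟩ := kp_exists_log _ hc (fun t => h0 _ (projIcc c d hcd t).2)
  refine ⟨ψ, hψ, fun t ht => ?_⟩
  rw [he, projIcc_of_mem hcd ht]

theorem kp_const_diff {c d : ℝ} {ψ₁ ψ₂ : ℝ → ℂ} (h₁ : ContinuousOn ψ₁ (Icc c d))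
    (h₂ : ContinuousOn ψ₂ (Icc c d))
    (he : ∀ t ∈ Icc c d, Complex.exp (ψ₁ t) = Complex.exp (ψ₂ t)) {t t' : ℝ}
    (ht : t ∈ Icc c d) (ht' : t' ∈ Icc c d) : ψ₁ t - ψ₂ t = ψ₁ t' - ψ₂ t' := by
  have hpi : (2 * Real.pi * Complex.I : ℂ) ≠ 0 := Complex.two_pi_I_ne_zero
  have hd : IsDiscrete (range ((↑) : ℤ → ℝ)) :=
    ⟨(Int.isClosedEmbedding_coe_real.isEmbedding.toHomeomorph.symm.isEmbedding).discreteTopology⟩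
  have key : ∀ s ∈ Icc c d, ∃ n : ℤ, ψ₁ s - ψ₂ s = n * (2 * Real.pi * Complex.I) := by
    intro s hs
    obtain ⟨n, hn⟩ := Complex.exp_eq_exp_iff_exists_int.1 (he s hs)
    exact ⟨n, by rw [hn]; ring⟩
  have := isPreconnected_Icc.constant_of_mapsTo hd
    (f := fun s : ℝ => ((ψ₁ s - ψ₂ s) / (2 * Real.pi * Complex.I)).re) (S := Icc c d)
    (Complex.continuous_re.comp_continuousOn ((h₁.sub h₂).div_const _))
    (by
      intro s hs
      obtain ⟨n, hn⟩ := key s hs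
      refine ⟨n, ?_⟩
      simp only [hn, mul_div_cancel_right₀ _ hpi, Complex.intCast_re]) ht ht'
  obtain ⟨n, hn⟩ := key t ht
  obtain ⟨m, hm⟩ := key t' ht'
  simp only [hn, hm, mul_div_cancel_right₀ _ hpi, Complex.intCast_re] at this
  rw [hn, hm, show n = m by exact_mod_cast this]

/-- Functions constant on the fibres descend to a continuous function on the plane. -/
theorem kp_descend {c d : ℝ} {z Ψ : ℝ → ℂ} (hz : Continuous z) (hΨ : Continuous Ψ)
    (hf : ∀ t ∈ Icc c d, ∀ t' ∈ Icc c d, z t = z t' → Ψ t = Ψ t') :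
    ∃ φ : ℂ → ℂ, Continuous φ ∧ ∀ t ∈ Icc c d, φ (z t) = Ψ t := by
  let K : Set ℂ := z '' Icc c d
  let q : Icc c d → K := fun t => ⟨z t, mem_image_of_mem _ t.2⟩
  have hq : Continuous q := (hz.comp continuous_subtype_val).subtype_mk _
  have hK : IsCompact K := isCompact_Icc.image hz
  have hqs : Function.Surjective q := by
    rintro ⟨_, t, ht, rfl⟩
    exact ⟨⟨t, ht⟩, rfl⟩
  have hqq : Topology.IsQuotientMap q := hq.isClosedMap.isQuotientMap hq hqs
  let G : C(Icc c d, ℂ) := ⟨fun t => Ψ t, hΨ.comp continuous_subtype_val⟩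
  let φ₀ : C(K, ℂ) := Topology.IsQuotientMap.lift (f := (⟨q, hq⟩ : C(Icc c d, K))) hqq G (by
    intro s t hst
    exact hf s s.2 t t.2 (congrArg Subtype.val hst))
  obtain ⟨φ, hφ⟩ := ContinuousMap.exists_restrict_eq hK.isClosed φ₀
  refine ⟨φ, φ.continuous, fun t ht => ?_⟩
  have h1 : φ₀ (q ⟨t, ht⟩) = Ψ t := by
    have := Topology.IsQuotientMap.lift_comp (f := (⟨q, hq⟩ : C(Icc c d, K))) hqq G (by
      intro s t hst
      exact hf s s.2 t t.2 (congrArg Subtype.val hst))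
    exact DFunLike.congr_fun this ⟨t, ht⟩
  rw [← h1, ← hφ]
  rfl

/-- `(z-b)^k` on the frontier of a bounded open set containing `b` does not extend to a
nonvanishing function. -/
theorem kp_no_extension {U : Set ℂ} (hUo : IsOpen U) (hUb : Bornology.IsBounded U) {b : ℂ}
    (hb : b ∈ U) {k : ℤ} {H : ℂ → ℂ} (hH : ContinuousOn H (closure U))
    (h0 : ∀ x ∈ closure U, H x ≠ 0) (hfr : ∀ x ∈ frontier U, H x = (x - b) ^ k) : k = 0 := by
  classical
  let h : ℂ → ℂ := fun x => if x ∈ U then H x else (x - b) ^ k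
  have hne : ∀ x, x ∉ U → x - b ≠ 0 := by
    intro x hx h
    exact hx (by rwa [sub_eq_zero.1 h])
  have hc : Continuous h := by
    refine continuous_if hfr hH ?_
    rw [show {a | a ∉ U} = Uᶜ from rfl, hUo.isClosed_compl.closure_eq]
    intro x hx
    exact ((continuousAt_id.sub continuousAt_const).zpow₀ k (Or.inl (hne x hx))).continuousWithinAt
  have hn : ∀ x, h x ≠ 0 := by
    intro x
    by_cases hx : x ∈ U
    · simpa [h, hx] using h0 x (subset_closure hx)
    · simpa [h, hx] using zpow_ne_zero k (hne x hx)
  obtain ⟨φ, hφ, he⟩ := kp_exists_log h hc hn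
  obtain ⟨ρ, hρ⟩ := hUb.subset_closedBall b
  let r : ℝ := max ρ 0 + 1
  have hr : 0 < r := by positivity
  let γ : ℝ → ℂ := fun t => b + Complex.exp (Real.log r + t * (2 * Real.pi * Complex.I))
  have hγU : ∀ t, γ t ∉ U := by
    intro t ht
    have := hρ ht
    rw [Metric.mem_closedBall, dist_eq_norm] at this
    simp only [γ, add_sub_cancel_left, Complex.norm_exp] at this
    have h1 : ((Real.log r : ℂ) + t * (2 * Real.pi * Complex.I)).re = Real.log r := by
      simp
    rw [h1, Real.exp_log hr] at this
    have := le_max_left ρ 0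
    simp only [r] at *
    linarith
  have hγc : Continuous γ := by fun_prop
  have hh : ∀ t, h (γ t) = Complex.exp (k * (Real.log r + t * (2 * Real.pi * Complex.I))) := by
    intro t
    simp only [h, hγU t, if_false]
    simp only [γ, add_sub_cancel_left, Complex.exp_int_mul]
  have := kp_const_diff (c := 0) (d := 1) (ψ₁ := fun t => φ (γ t))
    (ψ₂ := fun t : ℝ => (k : ℂ) * (Real.log r + t * (2 * Real.pi * Complex.I)))
    (hφ.comp hγc).continuousOn (by fun_prop)
    (fun t _ => by rw [he, hh]) (t := 0) (t' := 1) (by simp) (by simp)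
  have hγ01 : γ 0 = γ 1 := by
    simp [γ, Complex.exp_add]
  simp only [hγ01] at this
  have h2 : (k : ℂ) * (2 * Real.pi * Complex.I) = 0 := by
    have := sub_right_injective this
    push_cast at this
    linear_combination this.symm
  simpa [Real.pi_ne_zero] using h2

/-- Logarithm of `(x-a)/(x-b)` away from a ball containing `a` and `b`. -/
theorem kp_slit {p a b x : ℂ} {r : ℝ} (ha : dist a p < r / 3) (hb : dist b p < r / 3)
    (hx : r ≤ dist x p) : (x - a) / (x - b) ∈ Complex.slitPlane := by
  have h1 : dist a b < 2 * r / 3 := by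
    have := dist_triangle_right a b p
    linarith
  have h2 : 2 * r / 3 < dist x b := by
    have := dist_triangle x b p
    linarith
  have h3 : 0 < dist x b := lt_of_le_of_lt (by linarith [dist_nonneg (x := a) (y := b)]) h2
  have hxb : x - b ≠ 0 := sub_ne_zero.2 (dist_pos.1 h3)
  have h4 : (x - a) / (x - b) = 1 - (a - b) / (x - b) := by
    field_simp
    ring
  have h5 : ‖(a - b) / (x - b)‖ < 1 := by
    rw [norm_div, ← dist_eq_norm, ← dist_eq_norm, div_lt_one h3]
    linarith
  left
  rw [h4, Complex.sub_re, Complex.one_re]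
  have := Complex.re_le_norm ((a - b) / (x - b))
  linarith


/-- One-sided hair lemma. -/
theorem kp_hair {z : ℝ → ℂ} (hz : Continuous z) (hper : ∀ t, z (t + 1) = z t) {R : Set ℂ}
    (hRo : IsOpen R) (hRX : ∀ t, z t ∉ R) (hfr : frontier R ⊆ range z)
    (hRb : Bornology.IsBounded (closure R)ᶜ) {s δ : ℝ} (hδ : 0 < δ) (hδ2 : δ < 1 / 2)
    (hinj : ∀ t ∈ Icc (s - δ) (s + δ), ∀ t', z t = z t' → ∃ n : ℤ, t' = t + n)
    (hs : z s ∈ frontier R) : ∀ y ∈ Icc s (s + δ), z y ∈ frontier R := by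
  intro y hy
  by_contra hyF
  -- last parameter before `y` on the frontier
  have hcl : IsClosed (z ⁻¹' frontier R) := isClosed_frontier.preimage hz
  have hcomp : IsCompact (Icc s y ∩ z ⁻¹' frontier R) := isCompact_Icc.inter_right hcl
  obtain ⟨u, ⟨⟨hsu, huy⟩, huF⟩, humax⟩ := hcomp.exists_isGreatest ⟨s, ⟨le_rfl, hy.1⟩, hs⟩
  have huy' : u < y := lt_of_le_of_ne huy (by rintro rfl; exact hyF huF)
  have hgap : ∀ t, u < t → t ≤ y → z t ∉ frontier R := by
    intro t h1 h2 h3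
    exact absurd (humax ⟨⟨by linarith, h2⟩, h3⟩) (not_le.2 h1)
  have hy2 := hy.2
  have hint : ∀ n : ℤ, ∀ x : ℝ, x = n → -1 < x → x < 1 → x = 0 := by
    intro n x h1 h2 h3
    rw [h1] at h2 h3 ⊢
    have h4 : (-1 : ℤ) < n := by exact_mod_cast h2
    have h5 : n < (1 : ℤ) := by exact_mod_cast h3
    have : n = 0 := by omega
    simp [this]
  -- injectivity on windows of length less than one
  have hinj' : ∀ t ∈ Icc (s - δ) (s + δ), ∀ t', |t' - t| < 1 → z t = z t' → t = t' := by
    intro t ht t' h1 h2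
    obtain ⟨n, hn⟩ := hinj t ht t' h2
    rw [abs_lt] at h1
    have := hint n (t' - t) (by linarith) h1.1 h1.2
    linarith
  have hpern : ∀ (n : ℤ) t, z (t + n) = z t := by
    intro n t
    have : Function.Periodic z 1 := hper
    simpa using this.int_mul n t
  -- frontier is in `z [y-1,u]`
  have hfr' : frontier R ⊆ z '' Icc (y - 1) u := by
    intro x hx
    obtain ⟨t, rfl⟩ := hfr hx
    obtain ⟨n, hn, -⟩ := existsUnique_add_zsmul_mem_Ico (zero_lt_one' ℝ) t (y - 1)
    simp only [zsmul_eq_mul, mul_one, sub_add_cancel] at hn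
    refine ⟨t + n, ⟨hn.1, ?_⟩, hpern n t⟩
    by_contra hlt
    push Not at hlt
    exact hgap _ hlt hn.2.le (by rwa [hpern])
  -- the ball around the tip
  have hK' : IsCompact (z '' Icc (y - 1) (s - δ)) := isCompact_Icc.image hz
  have htip : z u ∉ z '' Icc (y - 1) (s - δ) := by
    rintro ⟨t, ⟨h1, h2⟩, h3⟩
    have := hinj' u ⟨by linarith, by linarith⟩ t (by rw [abs_lt]; constructor <;> linarith) h3.symm
    linarith
  obtain ⟨r, hr, hball⟩ := Metric.isOpen_iff.1 hK'.isClosed.isOpen_compl _ htip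
  have hfar : ∀ t ∈ Icc (y - 1) (s - δ), r ≤ dist (z t) (z u) := by
    intro t ht
    by_contra hlt
    exact hball (Metric.mem_ball.2 (not_le.1 hlt)) (mem_image_of_mem z ht)
  obtain ⟨a, haR, ha⟩ := Metric.mem_closure_iff.1 (frontier_subset_closure huF) (r / 3)
    (by positivity)
  rw [dist_comm] at ha
  obtain ⟨ε, hε, hεu⟩ := Metric.continuous_iff.1 hz u (r / 3) (by positivity)
  obtain ⟨y', huy1, hyy, hyε⟩ : ∃ y', u < y' ∧ y' < y ∧ y' < u + ε := by
    obtain ⟨y', h1, h2⟩ := exists_between (lt_min huy' (by linarith : u < u + ε))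
    exact ⟨y', h1, lt_of_lt_of_le h2 (min_le_left _ _), lt_of_lt_of_le h2 (min_le_right _ _)⟩
  have hb : dist (z y') (z u) < r / 3 := hεu y' (by
    rw [Real.dist_eq, abs_lt]; constructor <;> linarith)
  set b := z y' with hbdef
  have hbU : b ∈ (closure R)ᶜ := by
    rw [closure_eq_self_union_frontier]
    rintro (h | h)
    · exact hRX _ h
    · exact hgap _ huy1 hyy.le h
  have hza : ∀ t, z t - a ≠ 0 := by
    intro t h
    exact hRX t (by rwa [sub_eq_zero.1 h])
  have hzb : ∀ t ∈ Icc (y - 1) u, z t - b ≠ 0 := by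
    intro t ht h
    have := hinj' y' ⟨by linarith, by linarith⟩ t
      (by rw [abs_lt]; constructor <;> linarith [ht.1, ht.2]) (sub_eq_zero.1 h).symm
    linarith [ht.2]
  obtain ⟨ψ, hψ, hψe⟩ := kp_log_Icc (y - 1) u (by linarith) (fun t => (z t - a) / (z t - b))
    (ContinuousOn.div (by fun_prop) (by fun_prop) hzb)
    (fun t ht => div_ne_zero (hza t) (hzb t ht))
  have hsub : Icc (y - 1) (s - δ) ⊆ Icc (y - 1) u := Icc_subset_Icc_right (by linarith)
  have hconst : ∀ t ∈ Icc (y - 1) (s - δ), ∀ t' ∈ Icc (y - 1) (s - δ),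
      ψ t - Complex.log ((z t - a) / (z t - b)) = ψ t' - Complex.log ((z t' - a) / (z t' - b)) := by
    intro t ht t' ht'
    refine kp_const_diff (c := y - 1) (d := s - δ)
      (ψ₂ := fun t => Complex.log ((z t - a) / (z t - b))) hψ.continuousOn ?_ ?_ ht ht'
    · refine ContinuousOn.clog ?_ (fun t ht => kp_slit ha hb (hfar t ht))
      exact ContinuousOn.div (by fun_prop) (by fun_prop) (fun t ht => hzb t (hsub ht))
    · intro t ht
      rw [hψe t (hsub ht), Complex.exp_log (div_ne_zero (hza t) (hzb t (hsub ht)))]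
  obtain ⟨φ, hφ, hφe⟩ := kp_descend (c := y - 1) (d := u) hz hψ (by
    intro t ht t' ht' h
    by_cases h1 : s - δ ≤ t
    · rw [hinj' t ⟨h1, by linarith [ht.2]⟩ t'
        (by rw [abs_lt]; constructor <;> linarith [ht.1, ht.2, ht'.1, ht'.2]) h]
    by_cases h2 : s - δ ≤ t'
    · rw [hinj' t' ⟨h2, by linarith [ht'.2]⟩ t
        (by rw [abs_lt]; constructor <;> linarith [ht.1, ht.2, ht'.1, ht'.2]) h.symm]
    have := hconst t ⟨ht.1, by linarith⟩ t' ⟨ht'.1, by linarith⟩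
    rw [h] at this
    exact sub_left_injective this)
  -- contradiction
  have haU : a ∉ closure (closure R)ᶜ := by
    rw [closure_compl]
    intro h
    exact h (interior_mono subset_closure (by rwa [hRo.interior_eq]))
  have hne : ∀ x ∈ closure (closure R)ᶜ, x - a ≠ 0 := by
    intro x hx h
    exact haU (by rwa [← sub_eq_zero.1 h])
  have h10 := kp_no_extension (U := (closure R)ᶜ) isClosed_closure.isOpen_compl hRb hbU (k := 1)
    (H := fun x => Complex.exp (-φ x) * (x - a))
    (by fun_prop) (fun x hx => mul_ne_zero (Complex.exp_ne_zero _) (hne x hx)) (by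
      intro x hx
      have hx' : x ∈ frontier R := by
        rw [frontier_compl] at hx
        exact frontier_closure_subset hx
      obtain ⟨t, ht, rfl⟩ := hfr' hx'
      simp only [zpow_one]
      rw [hφe t ht, Complex.exp_neg, hψe t ht]
      have h1 := hza t
      have h2 := hzb t ht
      field_simp)
  exact one_ne_zero h10

/-- If a crossing splits the curve into a simple loop and another loop meeting only there, four
disjoint open sets bounded by the curve cannot all be adjacent to it. -/
theorem kp_star {z : ℝ → ℂ} (hz : Continuous z) {t₁ t₂ t₃ c d : ℝ} {p : ℂ}
    (h12 : t₁ < t₂) (h23 : t₂ < t₃) (h2c : t₂ < c) (hd3 : d < t₃)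
    (h1 : z t₁ = p) (h2 : z t₂ = p) (h3 : z t₃ = p)
    (hp : ∀ t ∈ Icc t₁ t₃, z t = p → t = t₁ ∨ t = t₂ ∨ t = t₃)
    (hfib : ∀ t ∈ Icc t₁ t₃, ∀ t' ∈ Icc t₁ t₃, z t = z t' →
      t = t' ∨ z t = p ∨ (t ∈ Icc c d ∧ t' ∈ Icc c d))
    (R : Fin 4 → Set ℂ) (hRo : ∀ i, IsOpen (R i)) (hdisj : ∀ i j, i ≠ j → Disjoint (R i) (R j))
    (hRX : ∀ i t, z t ∉ R i) (hfr : ∀ i, frontier (R i) ⊆ z '' Icc t₁ t₃)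
    (hpR : ∀ i, p ∈ closure (R i)) (hRb : ∀ i, i ≠ 0 → Bornology.IsBounded (R i)) : False := by
  have hK' : IsCompact (z '' Icc c d) := isCompact_Icc.image hz
  have htip : p ∉ z '' Icc c d := by
    rintro ⟨t, ⟨hc, hd⟩, h⟩
    rcases hp t ⟨by linarith, by linarith⟩ h with h | h | h <;> linarith
  obtain ⟨r, hr, hball⟩ := Metric.isOpen_iff.1 hK'.isClosed.isOpen_compl _ htip
  have hfar : ∀ t ∈ Icc c d, r ≤ dist (z t) p := by
    intro t ht
    by_contra hlt
    exact hball (Metric.mem_ball.2 (not_le.1 hlt)) (mem_image_of_mem z ht)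
  have hex : ∀ i, ∃ a ∈ R i, dist a p < r / 3 := by
    intro i
    obtain ⟨a, haR, ha⟩ := Metric.mem_closure_iff.1 (hpR i) (r / 3) (by positivity)
    exact ⟨a, haR, by rwa [dist_comm]⟩
  choose a haR ha using hex
  have hza : ∀ i t, z t - a i ≠ 0 := by
    intro i t h
    exact hRX i t (by rw [sub_eq_zero.1 h]; exact haR i)
  -- logarithms along the parameter
  have hlog : ∀ i : Fin 3, ∃ ψ : ℝ → ℂ, Continuous ψ ∧
      ∀ t, Complex.exp (ψ t) = (z t - a i.succ) / (z t - a 0) := by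
    intro i
    exact kp_exists_log _ (Continuous.div (by fun_prop) (by fun_prop) (hza 0))
      (fun t => div_ne_zero (hza _ t) (hza 0 t))
  choose ψ hψ hψe using hlog
  have hconst : ∀ i, ∀ t ∈ Icc c d, ∀ t' ∈ Icc c d, z t = z t' → ψ i t = ψ i t' := by
    intro i t ht t' ht' h
    have := kp_const_diff (c := c) (d := d) (ψ₁ := ψ i)
      (ψ₂ := fun t => Complex.log ((z t - a i.succ) / (z t - a 0))) (hψ i).continuousOn
      (by
        refine ContinuousOn.clog ?_ (fun t ht => kp_slit (ha _) (ha 0) (hfar t ht))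
        exact ContinuousOn.div (by fun_prop) (by fun_prop) (fun t ht => hza 0 t))
      (fun t ht => by rw [hψe, Complex.exp_log (div_ne_zero (hza _ t) (hza 0 t))]) ht ht'
    simp only [h] at this
    exact sub_left_injective this
  have hm : ∀ i, ∃ n : ℤ, ψ i t₂ = ψ i t₁ + n * (2 * Real.pi * Complex.I) := fun i =>
    Complex.exp_eq_exp_iff_exists_int.1 (by rw [hψe, hψe, h1, h2])
  have hn : ∀ i, ∃ n : ℤ, ψ i t₃ = ψ i t₂ + n * (2 * Real.pi * Complex.I) := fun i =>
    Complex.exp_eq_exp_iff_exists_int.1 (by rw [hψe, hψe, h2, h3])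
  choose m hm using hm
  choose n hn using hn
  -- an integral relation
  obtain ⟨k, hk0, hkm, hkn⟩ : ∃ k : Fin 3 → ℤ, k ≠ 0 ∧ ∑ i, m i * k i = 0 ∧ ∑ i, n i * k i = 0 := by
    have hdet : (Matrix.of ![m, n, 0] : Matrix (Fin 3) (Fin 3) ℤ).det = 0 :=
      Matrix.det_eq_zero_of_row_eq_zero 2 (by intro j; simp)
    obtain ⟨v, hv, hM⟩ := Matrix.exists_mulVec_eq_zero_iff.2 hdet
    refine ⟨v, hv, ?_, ?_⟩
    · simpa [Matrix.mulVec, dotProduct] using congrFun hM 0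
    · simpa [Matrix.mulVec, dotProduct] using congrFun hM 1
  let Ψ : ℝ → ℂ := fun t => ∑ i, (k i : ℂ) * ψ i t
  have hΨ : Continuous Ψ := continuous_finsetSum _ (fun i _ => continuous_const.mul (hψ i))
  have hΨ12 : Ψ t₂ = Ψ t₁ := by
    have : (∑ i, (m i : ℂ) * k i) = 0 := by exact_mod_cast hkm
    simp only [Ψ, hm, Fin.sum_univ_three] at this ⊢
    linear_combination (2 * Real.pi * Complex.I) * this
  have hΨ23 : Ψ t₃ = Ψ t₂ := by
    have : (∑ i, (n i : ℂ) * k i) = 0 := by exact_mod_cast hkn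
    simp only [Ψ, hn, Fin.sum_univ_three] at this ⊢
    linear_combination (2 * Real.pi * Complex.I) * this
  have hΨp : ∀ t ∈ Icc t₁ t₃, z t = p → Ψ t = Ψ t₁ := by
    intro t ht h
    rcases hp t ht h with rfl | rfl | rfl
    · rfl
    · exact hΨ12
    · rw [hΨ23, hΨ12]
  obtain ⟨φ, hφ, hφe⟩ := kp_descend (c := t₁) (d := t₃) hz hΨ (by
    intro t ht t' ht' h
    rcases hfib t ht t' ht' h with h' | h' | ⟨h', h''⟩
    · rw [h']
    · rw [hΨp t ht h', hΨp t' ht' (h ▸ h')]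
    · simp only [Ψ, hconst _ t h' t' h'' h])
  obtain ⟨i, hi⟩ : ∃ i, k i ≠ 0 := by
    by_contra hall
    push Not at hall
    exact hk0 (funext hall)
  have hcl : ∀ j, j ≠ i.succ → ∀ x ∈ closure (R i.succ), x - a j ≠ 0 := by
    intro j hj x hx h
    rw [sub_eq_zero.1 h] at hx
    obtain ⟨w, hw1, hw2⟩ := mem_closure_iff.1 hx (R j) (hRo j) (haR j)
    exact (Set.disjoint_left.1 (hdisj j i.succ hj)) hw1 hw2
  have h0i : (0 : Fin 4) ≠ i.succ := (Fin.succ_ne_zero i).symm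
  apply hi
  have hji : ∀ j ∈ Finset.univ.erase i, j.succ ≠ i.succ := by
    intro j hj h
    exact (Finset.mem_erase.1 hj).1 (Fin.succ_injective _ h)
  refine kp_no_extension (hRo i.succ) (hRb _ h0i.symm) (haR i.succ) (k := k i)
    (H := fun x => Complex.exp (φ x) * ((x - a 0) ^ (k i) *
      ∏ j ∈ Finset.univ.erase i, ((x - a j.succ) / (x - a 0)) ^ (- k j))) ?_ ?_ ?_
  · refine ContinuousOn.mul (by fun_prop) (ContinuousOn.mul ?_ ?_)
    · exact ContinuousOn.zpow₀ (by fun_prop) _ (fun x hx => Or.inl (hcl 0 h0i x hx))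
    · refine continuousOn_finsetProd _ (fun j hj => ?_)
      refine ContinuousOn.zpow₀ ?_ _ (fun x hx => Or.inl
        (div_ne_zero (hcl _ (hji j hj) x hx) (hcl 0 h0i x hx)))
      exact ContinuousOn.div (by fun_prop) (by fun_prop) (hcl 0 h0i)
  · intro x hx
    refine mul_ne_zero (Complex.exp_ne_zero _) (mul_ne_zero (zpow_ne_zero _ (hcl 0 h0i x hx)) ?_)
    exact Finset.prod_ne_zero_iff.2 (fun j hj => zpow_ne_zero _
        (div_ne_zero (hcl _ (hji j hj) x hx) (hcl 0 h0i x hx)))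
  · intro x hx
    obtain ⟨t, ht, rfl⟩ := hfr _ hx
    have e1 : Complex.exp (φ (z t)) = ∏ j, ((z t - a j.succ) / (z t - a 0)) ^ (k j) := by
      rw [hφe t ht]
      simp only [Ψ, Complex.exp_sum, Complex.exp_int_mul, hψe]
    simp only [e1]
    rw [← Finset.mul_prod_erase _ _ (Finset.mem_univ i)]
    have e2 : (∏ j ∈ Finset.univ.erase i, ((z t - a j.succ) / (z t - a 0)) ^ (k j)) *
        (∏ j ∈ Finset.univ.erase i, ((z t - a j.succ) / (z t - a 0)) ^ (- k j)) = 1 := by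
      rw [← Finset.prod_mul_distrib]
      refine Finset.prod_eq_one (fun j _ => ?_)
      rw [← zpow_add₀ (div_ne_zero (hza _ t) (hza 0 t))]
      simp
    have e3 : ((z t - a i.succ) / (z t - a 0)) ^ (k i) * (z t - a 0) ^ (k i)
        = (z t - a i.succ) ^ (k i) := by
      rw [← mul_zpow, div_mul_cancel₀ _ (hza 0 t)]
    rw [← e3]
    linear_combination (((z t - a i.succ) / (z t - a 0)) ^ (k i) * (z t - a 0) ^ (k i)) * e2


theorem kp_chart (q : Sphere2) : ∃ (τ : ℂ → Sphere2) (σ : Sphere2 → ℂ), Continuous τ ∧ IsOpenMap τ ∧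
    (∀ w, τ w ≠ q) ∧ (∀ x, x ≠ q → τ (σ x) = x) ∧ (∀ w, σ (τ w) = w) ∧ ContinuousOn σ {q}ᶜ := by
  have : Fact (Module.finrank ℝ (EuclideanSpace ℝ (Fin 3)) = 2 + 1) := ⟨by simp⟩
  let e := stereographic' 2 q
  let L := Complex.orthonormalBasisOneI.repr
  have hs : e.source = {q}ᶜ := stereographic'_source q
  have ht : e.target = univ := stereographic'_target q
  have hmem : ∀ w, L w ∈ e.target := fun w => by rw [ht]; trivial
  refine ⟨fun w => e.symm (L w), fun x => L.symm (e x), ?_, ?_, ?_, ?_, ?_, ?_⟩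
  · have : Continuous e.symm := by
      rw [← continuousOn_univ, ← ht]
      exact e.continuousOn_symm
    exact this.comp L.continuous
  · intro V hV
    have h1 : IsOpen (L '' V) := L.toHomeomorph.isOpenMap V hV
    have := e.symm.isOpen_image_of_subset_source h1 (by
      intro x _
      show x ∈ e.target
      rw [ht]; trivial)
    rwa [image_image] at this
  · intro w h
    have := e.map_target (hmem w)
    rw [hs] at this
    exact this h
  · intro x hx
    have : x ∈ e.source := by rw [hs]; exact hx
    simp [e.left_inv this]
  · intro w
    simp [e.right_inv (hmem w)]
  · have := e.continuousOn
    rw [hs] at this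
    exact L.symm.continuous.comp_continuousOn this

theorem kp_bounded {q : Sphere2} {τ : ℂ → Sphere2} {σ : Sphere2 → ℂ} (hστ : ∀ w, σ (τ w) = w)
    (hσ : ContinuousOn σ {q}ᶜ) {C : Set Sphere2} (hC : IsClosed C) (hq : q ∉ C) :
    Bornology.IsBounded (τ ⁻¹' C) := by
  have h1 : IsCompact (σ '' C) := hC.isCompact.image_of_continuousOn
    (hσ.mono (fun x hx h => hq (by rw [← (h : x = q)]; exact hx)))
  refine h1.isBounded.subset (fun w hw => ⟨τ w, hw, hστ w⟩)

namespace KnotProjection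

theorem kp_locConn : LocallyConnectedSpace Sphere2 := by
  have : Fact (Module.finrank ℝ (EuclideanSpace ℝ (Fin 3)) = 2 + 1) := ⟨by simp⟩
  exact ChartedSpace.locallyConnectedSpace (EuclideanSpace ℝ (Fin 2)) Sphere2

variable (P : KnotProjection)

theorem kp_image_closed : IsClosed P.image := (isCompact_range P.f.continuous).isClosed

variable {P}

theorem IsRegion.kp_open {R : Set Sphere2} (h : P.IsRegion R) : IsOpen R := by
  have := kp_locConn
  obtain ⟨x, -, rfl⟩ := h
  exact P.kp_image_closed.isOpen_compl.connectedComponentIn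

theorem IsRegion.kp_subset {R : Set Sphere2} (h : P.IsRegion R) : R ⊆ P.imageᶜ := by
  obtain ⟨x, -, rfl⟩ := h
  exact connectedComponentIn_subset _ _

theorem IsRegion.kp_nonempty {R : Set Sphere2} (h : P.IsRegion R) : R.Nonempty := by
  obtain ⟨x, hx, rfl⟩ := h
  exact ⟨x, mem_connectedComponentIn hx⟩

theorem IsRegion.kp_eq {R S : Set Sphere2} (h : P.IsRegion R) (h' : P.IsRegion S)
    {y : Sphere2} (hy : y ∈ R) (hy' : y ∈ S) : R = S := by
  obtain ⟨x, -, rfl⟩ := h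
  obtain ⟨x', -, rfl⟩ := h'
  rw [connectedComponentIn_eq hy, connectedComponentIn_eq hy']

theorem IsRegion.kp_frontier {R : Set Sphere2} (h : P.IsRegion R) : frontier R ⊆ P.image := by
  intro y hy
  by_contra hyX
  have hS : P.IsRegion (connectedComponentIn P.imageᶜ y) := ⟨y, hyX, rfl⟩
  have hyS := mem_connectedComponentIn (F := P.imageᶜ) hyX
  obtain ⟨w, hw1, hw2⟩ := mem_closure_iff.1 (frontier_subset_closure hy) _ hS.kp_open hyS
  have heq := hS.kp_eq h hw1 hw2
  rw [heq] at hyS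
  rw [h.kp_open.frontier_eq] at hy
  exact hy.2 hyS

theorem kp_coe_eq {t t' : ℝ} : ((t : Param) = (t' : Param)) ↔ ∃ n : ℤ, t' = t + n := by
  rw [eq_comm, ← sub_eq_zero, ← AddCircle.coe_sub, AddCircle.coe_eq_zero_iff]
  constructor
  · rintro ⟨n, hn⟩
    exact ⟨n, by simp at hn; linarith⟩
  · rintro ⟨n, hn⟩
    exact ⟨n, by simp [hn]⟩

theorem kp_coe_add_int (t : ℝ) (n : ℤ) : ((t + n : ℝ) : Param) = (t : Param) :=
  (kp_coe_eq.2 ⟨n, rfl⟩).symm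

theorem kp_inj {x y : Param} (hx : P.f x ∉ P.crossings) (h : P.f x = P.f y) : x = y := by
  by_contra hne
  apply hx
  have hfin := P.fibers_finite (P.f x)
  refine le_antisymm (P.fibers_le_two _) ?_
  show 2 ≤ (P.f ⁻¹' {P.f x}).ncard
  rw [← Set.ncard_pair hne]
  refine Set.ncard_le_ncard ?_ hfin
  rintro w (rfl | rfl)
  · rfl
  · exact h.symm

theorem kp_crossings_closed (P : KnotProjection) : IsClosed P.crossings :=
  P.crossings_finite.isClosed

theorem kp_cont (P : KnotProjection) : Continuous (fun t : ℝ => P.f (t : Param)) :=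
  P.f.continuous.comp (AddCircle.continuous_mk' 1)

/-- The frontier of a region propagates along the curve away from crossings. -/
theorem kp_hair_sphere {R : Set Sphere2} (hR : P.IsRegion R) {s : ℝ}
    (hs : P.f (s : Param) ∈ frontier R) (hsc : P.f (s : Param) ∉ P.crossings) :
    {t : ℝ | P.f (t : Param) ∈ frontier R} ∈ nhds s := by
  obtain ⟨q, hq⟩ := hR.kp_nonempty
  obtain ⟨τ, σ, hτc, hτo, hτq, hτσ, hστ, hσ⟩ := kp_chart q
  have hfq : ∀ x, P.f x ≠ q := fun x h => hR.kp_subset hq ⟨x, h⟩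
  let z : ℝ → ℂ := fun t => σ (P.f (t : Param))
  have hz : Continuous z := hσ.comp_continuous P.kp_cont (fun t => hfq _)
  have hτz : ∀ t, τ (z t) = P.f (t : Param) := fun t => hτσ _ (hfq _)
  have hfrR : frontier (τ ⁻¹' R) = τ ⁻¹' frontier R :=
    (hτo.preimage_frontier_eq_frontier_preimage hτc R).symm
  have hmemfr : ∀ t, z t ∈ frontier (τ ⁻¹' R) ↔ P.f (t : Param) ∈ frontier R := by
    intro t
    rw [hfrR, mem_preimage, hτz]
  have hRX : ∀ t, z t ∉ τ ⁻¹' R := by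
    intro t ht
    rw [mem_preimage, hτz] at ht
    exact hR.kp_subset ht ⟨_, rfl⟩
  have hfr : ∀ x ∈ frontier (τ ⁻¹' R), ∃ t : ℝ, z t = x := by
    intro x hx
    rw [hfrR] at hx
    obtain ⟨w, hw⟩ := hR.kp_frontier hx
    obtain ⟨t, rfl⟩ := QuotientAddGroup.mk_surjective w
    exact ⟨t, by show σ (P.f _) = x; rw [← hστ x, ← hw]⟩
  have hb : Bornology.IsBounded (closure (τ ⁻¹' R))ᶜ := by
    refine (kp_bounded (C := Rᶜ) hστ hσ hR.kp_open.isClosed_compl (fun h => h hq)).subset ?_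
    rw [preimage_compl]
    exact compl_subset_compl.2 subset_closure
  have hnb : (fun t : ℝ => P.f (t : Param)) ⁻¹' P.crossingsᶜ ∈ nhds s :=
    (P.kp_crossings_closed.isOpen_compl.preimage P.kp_cont).mem_nhds hsc
  obtain ⟨ε, hε, hεs⟩ := Metric.nhds_basis_closedBall.mem_iff.1 hnb
  rw [Real.closedBall_eq_Icc] at hεs
  let δ := min ε (1 / 4)
  have hδ : 0 < δ := lt_min hε (by norm_num)
  have hδ2 : δ < 1 / 2 := lt_of_le_of_lt (min_le_right _ _) (by norm_num)
  have hδε : δ ≤ ε := min_le_left _ _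
  have hinj : ∀ t ∈ Icc (s - δ) (s + δ), ∀ t', z t = z t' → ∃ n : ℤ, t' = t + n := by
    intro t ht t' h
    have h1 : P.f (t : Param) = P.f (t' : Param) := by rw [← hτz, ← hτz, h]
    exact kp_coe_eq.1 (kp_inj (hεs ⟨by linarith [ht.1], by linarith [ht.2]⟩) h1)
  have hper : ∀ (n : ℤ) t, z (t + n) = z t := fun n t =>
    congrArg (fun x => σ (P.f x)) (kp_coe_add_int t n)
  have right := kp_hair hz (fun t => by rw [← hper 1 t, Int.cast_one])
    (hR.kp_open.preimage hτc) hRX (fun x hx => hfr x hx) hb hδ hδ2 hinj ((hmemfr s).2 hs)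
  have left := kp_hair (z := fun t => z (-t)) (s := -s) (hz.comp continuous_neg)
    (fun t => by
      show z _ = z _
      rw [← hper (-1) (-t)]
      congr 1
      push_cast
      ring)
    (hR.kp_open.preimage hτc) (fun t => hRX _)
    (fun x hx => by
      obtain ⟨t, ht⟩ := hfr x hx
      exact ⟨-t, by simpa using ht⟩) hb hδ hδ2
    (by
      intro t ht t' h
      obtain ⟨n, hn⟩ := hinj (-t) ⟨by linarith [ht.2], by linarith [ht.1]⟩ (-t') h
      exact ⟨-n, by push_cast; linarith⟩)
    (by simpa using (hmemfr s).2 hs)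
  refine Filter.mem_of_superset (Icc_mem_nhds (a := s - δ) (b := s + δ) (by linarith)
    (by linarith)) ?_
  intro t ht
  rw [mem_ofPred_eq, ← hmemfr]
  rcases le_total s t with h | h
  · exact right t ⟨h, ht.2⟩
  · have := left (-t) ⟨by linarith, by linarith [ht.1]⟩
    simpa using this

theorem kp_int_cases {t₁ t₂ t : ℝ} (h1 : t₁ < t₂) (h2 : t₂ < t₁ + 1) (ht : t ∈ Icc t₁ (t₁ + 1))
    {n : ℤ} (h : t = t₁ + n ∨ t = t₂ + n) : t = t₁ ∨ t = t₂ ∨ t = t₁ + 1 := by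
  obtain ⟨ht1, ht2⟩ := ht
  rcases h with h | h
  · have a1 : (-1 : ℝ) < n := by linarith
    have a2 : (n : ℝ) < 2 := by linarith
    have b1 : (-1 : ℤ) < n := by exact_mod_cast a1
    have b2 : n < (2 : ℤ) := by exact_mod_cast a2
    have : n = 0 ∨ n = 1 := by omega
    rcases this with rfl | rfl
    · left; simpa using h
    · right; right; simpa using h
  · have a1 : (-1 : ℝ) < n := by linarith
    have a2 : (n : ℝ) < 1 := by linarith
    have b1 : (-1 : ℤ) < n := by exact_mod_cast a1
    have b2 : n < (1 : ℤ) := by exact_mod_cast a2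
    have : n = 0 := by omega
    subst this
    right; left; simpa using h

/-- No crossing of a reduced projection carries a simple loop free of other crossings. -/
theorem kp_no_loop (hred : P.Reduced) {p : Sphere2} (hp : p ∈ P.crossings) {t₁ t₂ : ℝ}
    (h12 : t₁ < t₂) (h21 : t₂ < t₁ + 1) (h1 : P.f (t₁ : Param) = p) (h2 : P.f (t₂ : Param) = p)
    (hfibp : ∀ t : ℝ, P.f (t : Param) = p → ∃ n : ℤ, t = t₁ + n ∨ t = t₂ + n)
    (hloop : ∀ t ∈ Ioo t₁ t₂, P.f (t : Param) ∉ P.crossings) : False := by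
  have hcard : 4 ≤ Nat.card {R : Set Sphere2 | P.IsRegion R ∧ p ∈ frontier R} := by
    by_contra h
    exact hred p ⟨hp, not_le.1 h⟩
  set Q := {R : Set Sphere2 | P.IsRegion R ∧ p ∈ frontier R} with hQ
  have : Finite Q := Nat.finite_of_card_ne_zero (by omega)
  have := Fintype.ofFinite Q
  obtain ⟨g⟩ : Nonempty (Fin 4 ↪ Q) := by
    apply Function.Embedding.nonempty_of_card_le
    rw [Fintype.card_fin, ← Nat.card_eq_fintype_card]
    exact hcard
  have hg : ∀ i, P.IsRegion (g i : Set Sphere2) := fun i => (g i).2.1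
  have hgp : ∀ i, p ∈ frontier (g i : Set Sphere2) := fun i => (g i).2.2
  obtain ⟨q, hq⟩ := (hg 0).kp_nonempty
  obtain ⟨τ, σ, hτc, hτo, hτq, hτσ, hστ, hσ⟩ := kp_chart q
  have hfq : ∀ x, P.f x ≠ q := fun x h => (hg 0).kp_subset hq ⟨x, h⟩
  let z : ℝ → ℂ := fun t => σ (P.f (t : Param))
  have hz : Continuous z := hσ.comp_continuous P.kp_cont (fun t => hfq _)
  have hτz : ∀ t, τ (z t) = P.f (t : Param) := fun t => hτσ _ (hfq _)
  have hzf : ∀ t t', z t = z t' → P.f (t : Param) = P.f (t' : Param) := by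
    intro t t' h
    rw [← hτz, ← hτz, h]
  have hτp : τ (σ p) = p := by rw [← h1]; exact hτz t₁
  have hzp : ∀ t, z t = σ p ↔ P.f (t : Param) = p := by
    intro t
    constructor
    · intro h
      rw [← hτz, h, hτp]
    · intro h
      simp only [z, h]
  have h3 : P.f ((t₁ + 1 : ℝ) : Param) = p := by
    have := kp_coe_add_int t₁ 1
    rw [Int.cast_one] at this
    rw [this, h1]
  have hp' : ∀ t ∈ Icc t₁ (t₁ + 1), P.f (t : Param) = p → t = t₁ ∨ t = t₂ ∨ t = t₁ + 1 := by
    intro t ht h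
    obtain ⟨n, hn⟩ := hfibp t h
    exact kp_int_cases h12 h21 ht hn
  -- the remaining crossing parameters
  let T : Set ℝ := Icc t₂ (t₁ + 1) ∩ (fun t : ℝ => P.f (t : Param)) ⁻¹' (P.crossings \ {p})
  have hT : IsCompact T := isCompact_Icc.inter_right
    ((P.crossings_finite.subset sdiff_subset).isClosed.preimage P.kp_cont)
  have hTsub : ∀ t ∈ T, t₂ < t ∧ t < t₁ + 1 := by
    rintro t ⟨⟨ha, hb⟩, -, hc⟩
    refine ⟨lt_of_le_of_ne ha ?_, lt_of_le_of_ne hb ?_⟩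
    · rintro rfl; exact hc h2
    · rintro rfl; exact hc h3
  obtain ⟨c, d, hc, hd, hTcd⟩ : ∃ c d, t₂ < c ∧ d < t₁ + 1 ∧ T ⊆ Icc c d := by
    rcases T.eq_empty_or_nonempty with h | h
    · exact ⟨t₁ + 1, t₂, h21, h21, by rw [h]; exact empty_subset _⟩
    · obtain ⟨c, hc, hc'⟩ := hT.exists_isLeast h
      obtain ⟨d, hd, hd'⟩ := hT.exists_isGreatest h
      exact ⟨c, d, (hTsub c hc).1, (hTsub d hd).2, fun t ht => ⟨hc' ht, hd' ht⟩⟩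
  have hTmem : ∀ t ∈ Icc t₁ (t₁ + 1), P.f (t : Param) ∈ P.crossings → P.f (t : Param) ≠ p →
      t ∈ T := by
    intro t ht hcr hne
    refine ⟨⟨?_, ht.2⟩, hcr, hne⟩
    by_contra hlt
    push Not at hlt
    refine hloop t ⟨lt_of_le_of_ne ht.1 ?_, hlt⟩ hcr
    rintro rfl
    exact hne h1
  have hfr : ∀ i, frontier (τ ⁻¹' (g i : Set Sphere2)) = τ ⁻¹' frontier (g i : Set Sphere2) :=
    fun i => (hτo.preimage_frontier_eq_frontier_preimage hτc _).symm
  refine kp_star hz h12 h21 hc hd ((hzp _).2 h1) ((hzp _).2 h2) ((hzp _).2 h3)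
    (fun t ht h => hp' t ht ((hzp t).1 h)) ?_ (fun i => τ ⁻¹' (g i : Set Sphere2))
    (fun i => (hg i).kp_open.preimage hτc) ?_ ?_ ?_ ?_ ?_
  · intro t ht t' ht' h
    have hf := hzf t t' h
    by_cases hcr : P.f (t : Param) ∈ P.crossings
    · by_cases hpp : P.f (t : Param) = p
      · exact Or.inr (Or.inl ((hzp t).2 hpp))
      · exact Or.inr (Or.inr ⟨hTcd (hTmem t ht hcr hpp),
          hTcd (hTmem t' ht' (hf ▸ hcr) (hf ▸ hpp))⟩)
    · obtain ⟨n, hn⟩ := kp_coe_eq.1 (kp_inj hcr hf)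
      have a1 : (-2 : ℝ) < n := by linarith [ht.1, ht.2, ht'.1, ht'.2]
      have a2 : (n : ℝ) < 2 := by linarith [ht.1, ht.2, ht'.1, ht'.2]
      have b1 : (-2 : ℤ) < n := by exact_mod_cast a1
      have b2 : n < (2 : ℤ) := by exact_mod_cast a2
      have : n = -1 ∨ n = 0 ∨ n = 1 := by omega
      rcases this with rfl | rfl | rfl
      · right; left
        have : t' = t₁ := by push_cast at hn; linarith [ht.2, ht'.1]
        rw [h, hzp, this, h1]
      · left; simpa using hn.symm
      · right; left
        have : t = t₁ := by push_cast at hn; linarith [ht.1, ht'.2]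
        rw [hzp, this, h1]
  · intro i j hij
    rw [Set.disjoint_left]
    intro w hw hw'
    exact hij (g.injective (Subtype.ext ((hg i).kp_eq (hg j) hw hw')))
  · intro i t ht
    rw [mem_preimage, hτz] at ht
    exact (hg i).kp_subset ht ⟨_, rfl⟩
  · intro i x hx
    rw [hfr] at hx
    obtain ⟨w, hw⟩ := (hg i).kp_frontier hx
    obtain ⟨t, rfl⟩ := QuotientAddGroup.mk_surjective w
    obtain ⟨n, hn, -⟩ := existsUnique_add_zsmul_mem_Ico (zero_lt_one' ℝ) t t₁
    simp only [zsmul_eq_mul, mul_one] at hn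
    refine ⟨t + n, ⟨hn.1, hn.2.le⟩, ?_⟩
    simp only [z, kp_coe_add_int]
    rw [← hστ x, ← hw]
  · intro i
    have := frontier_subset_closure ((hfr i).symm ▸ (show σ p ∈ τ ⁻¹' frontier (g i : Set Sphere2)
      by rw [mem_preimage, hτp]; exact hgp i) : σ p ∈ frontier (τ ⁻¹' (g i : Set Sphere2)))
    exact this
  · intro i hi
    refine (kp_bounded (C := closure (g i : Set Sphere2)) hστ hσ isClosed_closure ?_).subset
      (preimage_mono subset_closure)
    intro h
    obtain ⟨w, hw1, hw2⟩ := mem_closure_iff.1 h _ (hg 0).kp_open hq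
    exact hi (g.injective (Subtype.ext ((hg i).kp_eq (hg 0) hw2 hw1)))


/-- If a parameter interval avoids `p`, the only crossing possibly on the frontier of `R`, and some
point of it is on the frontier, then all of it is. -/
theorem kp_interval {R : Set Sphere2} (hR : P.IsRegion R) {p : Sphere2}
    (honly : ∀ c ∈ P.crossings, c ∈ frontier R → c = p) {a b : ℝ}
    (hab : ∀ t ∈ Ioo a b, P.f (t : Param) ≠ p) {s : ℝ} (hs : s ∈ Ioo a b)
    (hsF : P.f (s : Param) ∈ frontier R) : ∀ t ∈ Ioo a b, P.f (t : Param) ∈ frontier R := by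
  let F : Set ℝ := {t : ℝ | P.f (t : Param) ∈ frontier R}
  have hF : IsClosed F := isClosed_frontier.preimage P.kp_cont
  have hint : ∀ t ∈ Ioo a b, t ∈ F → t ∈ interior F := by
    intro t ht htF
    exact mem_interior_iff_mem_nhds.2
      (kp_hair_sphere hR htF (fun hc => hab t ht (honly _ hc htF)))
  have := isPreconnected_Ioo.subset_left_of_subset_union (s := Ioo a b) (u := interior F) (v := Fᶜ)
    isOpen_interior hF.isOpen_compl
    (Set.disjoint_left.2 (fun x hx hx' => hx' (interior_subset hx)))
    (fun t ht => by
      by_cases h : t ∈ F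
      · exact Or.inl (hint t ht h)
      · exact Or.inr h)
    ⟨s, hs, hint s hs hsF⟩
  exact fun t ht => (show t ∈ F from interior_subset (this ht))

/-- The frontier of a region is not contained in one crossing. -/
theorem kp_frontier_not_point {R : Set Sphere2} (hR : P.IsRegion R) {p : Sphere2}
    (hp : p ∈ P.image) {w : Sphere2} (hw : w ∈ P.image) (hwp : w ≠ p) :
    ∃ y ∈ frontier R, y ≠ p := by
  by_contra hall
  push Not at hall
  obtain ⟨τ, σ, hτc, hτo, hτq, hτσ, hστ, hσ⟩ := kp_chart p
  have hfr : frontier (τ ⁻¹' R) = ∅ := by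
    rw [← hτo.preimage_frontier_eq_frontier_preimage hτc R, eq_empty_iff_forall_notMem]
    intro x hx
    exact hτq x (hall _ hx)
  obtain ⟨x, hx⟩ := hR.kp_nonempty
  have hxp : x ≠ p := by
    rintro rfl
    exact hR.kp_subset hx hp
  rcases frontier_eq_empty_iff.1 hfr with h | h
  · have : σ x ∈ τ ⁻¹' R := by rw [mem_preimage, hτσ x hxp]; exact hx
    rw [h] at this
    exact this
  · have : σ w ∈ τ ⁻¹' R := by rw [h]; trivial
    rw [mem_preimage, hτσ w hwp] at this
    exact hR.kp_subset this hw

/-- Every region of a reduced projection has two crossings on its boundary. -/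
theorem kp_two_crossings (hred : P.Reduced) {R : Set Sphere2} (hR : P.IsRegion R) :
    2 ≤ {c | c ∈ P.crossings ∧ c ∈ frontier R}.ncard := by
  by_contra hlt
  have hfin : {c | c ∈ P.crossings ∧ c ∈ frontier R}.Finite :=
    P.crossings_finite.subset (fun c hc => hc.1)
  have hle : {c | c ∈ P.crossings ∧ c ∈ frontier R}.ncard ≤ 1 := by omega
  rw [Set.ncard_le_one hfin] at hle
  obtain ⟨p, hp, honly⟩ : ∃ p ∈ P.crossings, ∀ c ∈ P.crossings, c ∈ frontier R → c = p := by
    by_cases h : ∃ c, c ∈ P.crossings ∧ c ∈ frontier R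
    · obtain ⟨c, hc⟩ := h
      exact ⟨c, hc.1, fun c' h1 h2 => hle c' ⟨h1, h2⟩ c hc⟩
    · push Not at h
      obtain ⟨p, hp⟩ := P.exists_crossing
      exact ⟨p, hp, fun c h1 h2 => absurd h2 (h c h1)⟩
  have hp2 : (P.f ⁻¹' {p}).ncard = 2 := hp
  obtain ⟨x₁, x₂, hne, hfib⟩ := Set.ncard_eq_two.1 hp2
  have hfx : ∀ x, P.f x = p ↔ x = x₁ ∨ x = x₂ := by
    intro x
    have : x ∈ P.f ⁻¹' {p} ↔ x ∈ ({x₁, x₂} : Set Param) := by rw [hfib]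
    simpa using this
  obtain ⟨t₁, rfl⟩ := QuotientAddGroup.mk_surjective x₁
  obtain ⟨t, rfl⟩ := QuotientAddGroup.mk_surjective x₂
  obtain ⟨n, hn, -⟩ := existsUnique_add_zsmul_mem_Ico (zero_lt_one' ℝ) t t₁
  simp only [zsmul_eq_mul, mul_one] at hn
  set t₂ : ℝ := t + n with ht₂
  have e2 : ((t₂ : ℝ) : Param) = (t : Param) := kp_coe_add_int t n
  have h1 : P.f (t₁ : Param) = p := (hfx _).2 (Or.inl rfl)
  have h2 : P.f (t₂ : Param) = p := (hfx _).2 (Or.inr e2)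
  have h12 : t₁ < t₂ := by
    refine lt_of_le_of_ne hn.1 (fun h => hne ?_)
    show (t₁ : Param) = (t : Param)
    rw [← e2, ← h]
  have h21 : t₂ < t₁ + 1 := hn.2
  have hfibp : ∀ s : ℝ, P.f (s : Param) = p → ∃ n : ℤ, s = t₁ + n ∨ s = t₂ + n := by
    intro s hs
    rcases (hfx _).1 hs with h | h
    · obtain ⟨m, hm⟩ := kp_coe_eq.1 (show ((t₁ : ℝ) : Param) = (s : Param) from h.symm)
      exact ⟨m, Or.inl hm⟩
    · obtain ⟨m, hm⟩ := kp_coe_eq.1 (show ((t₂ : ℝ) : Param) = (s : Param) from e2.trans h.symm)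
      exact ⟨m, Or.inr hm⟩
  -- the general interval step
  have step : ∀ a b : ℝ, a < b → b < a + 1 → P.f (a : Param) = p → P.f (b : Param) = p →
      (∀ s : ℝ, P.f (s : Param) = p → ∃ n : ℤ, s = a + n ∨ s = b + n) →
      ∀ s ∈ Ioo a b, P.f (s : Param) ∉ frontier R := by
    intro a b hab hba ha hb hf s hs hsF
    have hav : ∀ t ∈ Ioo a b, P.f (t : Param) ≠ p := by
      intro t ht h
      obtain ⟨m, hm⟩ := hf t h
      rcases kp_int_cases hab hba ⟨ht.1.le, by linarith [ht.2]⟩ hm with h | h | h <;>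
        linarith [ht.1, ht.2]
    have hall := kp_interval hR honly hav hs hsF
    exact kp_no_loop hred hp hab hba ha hb hf
      (fun t ht hc => hav t ht (honly _ hc (hall t ht)))
  have h3 : P.f ((t₁ + 1 : ℝ) : Param) = p := by
    have := kp_coe_add_int t₁ 1
    rw [Int.cast_one] at this
    rw [this, h1]
  have s1 := step t₁ t₂ h12 h21 h1 h2 hfibp
  have s2 := step t₂ (t₁ + 1) h21 (by linarith) h2 h3 (by
    intro s hs
    obtain ⟨m, hm | hm⟩ := hfibp s hs
    · exact ⟨m - 1, Or.inr (by push_cast; linarith)⟩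
    · exact ⟨m, Or.inl hm⟩)
  -- the frontier is contained in `{p}`
  have hw : P.f (((t₁ + t₂) / 2 : ℝ) : Param) ≠ p := by
    intro h
    obtain ⟨m, hm⟩ := hfibp _ h
    rcases kp_int_cases h12 h21 ⟨by linarith, by linarith⟩ hm with h | h | h <;> linarith
  obtain ⟨y, hy, hyp⟩ := kp_frontier_not_point hR ⟨_, h1⟩ ⟨_, rfl⟩ hw
  obtain ⟨x, hx⟩ := hR.kp_frontier hy
  obtain ⟨s, rfl⟩ := QuotientAddGroup.mk_surjective x
  obtain ⟨m, hm, -⟩ := existsUnique_add_zsmul_mem_Ico (zero_lt_one' ℝ) s t₁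
  simp only [zsmul_eq_mul, mul_one] at hm
  have hx' : P.f ((s + m : ℝ) : Param) = y := by rw [kp_coe_add_int]; exact hx
  rcases hm.1.eq_or_lt with h | h
  · exact hyp (by rw [← hx', ← h, h1])
  rcases lt_trichotomy (s + m) t₂ with h' | h' | h'
  · exact s1 _ ⟨h, h'⟩ (hx' ▸ hy)
  · exact hyp (by rw [← hx', h', h2])
  · exact s2 _ ⟨h', hm.2⟩ (hx' ▸ hy)

theorem kp_count (hred : P.Reduced) {c : Sphere2} (hc : c ∈ P.crossings)
    {S : Finset (Set Sphere2)} (hS : P.IndepRegionsFor c S) : 2 * S.card + 1 ≤ P.crossingNumber := by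
  classical
  let X : Finset Sphere2 := P.crossings_finite.toFinset
  have hX : ∀ x, x ∈ X ↔ x ∈ P.crossings := fun x => P.crossings_finite.mem_toFinset
  have hcard : P.crossingNumber = X.card := Nat.card_eq_card_finite_toFinset P.crossings_finite
  let B : Set Sphere2 → Finset Sphere2 := fun R => X.filter (fun x => x ∈ frontier R)
  have hB : ∀ R ∈ S, 2 ≤ (B R).card := by
    intro R hR
    have := kp_two_crossings hred (hS.1.1 R hR)
    rwa [show {c | c ∈ P.crossings ∧ c ∈ frontier R} = ((B R : Finset Sphere2) : Set Sphere2) by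
      ext x; simp [B, hX], Set.ncard_coe_finset] at this
  have hsub : S.biUnion B ⊆ X.erase c := by
    intro x hx
    obtain ⟨R, hR, hxR⟩ := Finset.mem_biUnion.1 hx
    obtain ⟨h1, h2⟩ := Finset.mem_filter.1 hxR
    refine Finset.mem_erase.2 ⟨?_, h1⟩
    rintro rfl
    exact hS.2 R hR h2
  have hdisj : (S : Set (Set Sphere2)).PairwiseDisjoint B := by
    intro R hR R' hR' hne
    refine Finset.disjoint_left.2 (fun x hx hx' => ?_)
    obtain ⟨h1, h2⟩ := Finset.mem_filter.1 hx
    obtain ⟨-, h3⟩ := Finset.mem_filter.1 hx'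
    exact hS.1.2 hR hR' hne x ((hX x).1 h1) ⟨h2, h3⟩
  have h1 := Finset.card_le_card hsub
  rw [Finset.card_biUnion hdisj] at h1
  have h2 : S.card * 2 ≤ ∑ R ∈ S, (B R).card := by
    rw [← smul_eq_mul]
    exact Finset.card_nsmul_le_sum _ _ _ hB
  have h3 := Finset.card_erase_add_one ((hX c).2 hc)
  omega

end KnotProjection

/-- **Lemma.**  For every reduced knot projection `P`, `IR(P) ≤ (c(P)-1)/2`,
equivalently `2·IR(P) ≤ c(P) - 1`. -/
theorem two_mul_IR_le
    (P : KnotProjection) (hred : P.Reduced) :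
    2 * P.IR + 1 ≤ P.crossingNumber := by
  have hpos : ∀ c ∈ P.crossings, 2 * P.IRat c + 1 ≤ P.crossingNumber := by
    intro c hc
    have hempty : P.IndepRegionsFor c ∅ := by
      refine ⟨⟨?_, ?_⟩, ?_⟩ <;> simp
    have h0 := KnotProjection.kp_count hred hc hempty
    have : P.IRat c ≤ (P.crossingNumber - 1) / 2 := by
      refine csSup_le ⟨0, ∅, hempty, rfl⟩ ?_
      rintro m ⟨S, hS, rfl⟩
      have := KnotProjection.kp_count hred hc hS
      omega
    omega
  obtain ⟨p, hp⟩ := P.exists_crossing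
  have h0 := hpos p hp
  have : P.IR ≤ (P.crossingNumber - 1) / 2 := by
    refine csSup_le ⟨_, p, hp, rfl⟩ ?_
    rintro m ⟨c, hc, rfl⟩
    have := hpos c hc
    omega
  omega
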